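/- The graded ring B = ℚ[Z₁,Z₂,Z₃,W₁,W₂,W₃,C] with relations W₁²+W₂² = Z₃², W₁²+W₃² = Z₂², W₂²+W₃² = Z₁², W₁²+W₂²+W₃² = C² is an integral domain of Krull dimension 3. -/

import Mathlib

open MvPolynomial

/-- Variables: `0,1,2 ↦ W₁,W₂,W₃`; `3,4,5 ↦ Z₁,Z₂,Z₃`; `6 ↦ C`. -/
noncomputable abbrev W₁ : MvPolynomial (Fin 7) ℚ := X 0
noncomputable abbrev W₂ : MvPolynomial (Fin 7) ℚ := X 1
noncomputable abbrev W₃ : MvPolynomial (Fin 7) ℚ := X 2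
noncomputable abbrev Z₁ : MvPolynomial (Fin 7) ℚ := X 3
noncomputable abbrev Z₂ : MvPolynomial (Fin 7) ℚ := X 4
noncomputable abbrev Z₃ : MvPolynomial (Fin 7) ℚ := X 5
noncomputable abbrev Cv : MvPolynomial (Fin 7) ℚ := X 6

/-- The ideal of the box variety relations. -/
noncomputable def boxIdeal : Ideal (MvPolynomial (Fin 7) ℚ) :=
  Ideal.span {W₁ ^ 2 + W₂ ^ 2 - Z₃ ^ 2, W₁ ^ 2 + W₃ ^ 2 - Z₂ ^ 2,
    W₂ ^ 2 + W₃ ^ 2 - Z₁ ^ 2, W₁ ^ 2 + W₂ ^ 2 + W₃ ^ 2 - Cv ^ 2}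

namespace Subring

variable {B : Type*} [CommRing B]

/-- The subring of all `r + t * z` with `r, t ∈ R`, where `z ^ 2 ∈ R`. -/
def adjoinSqrt (R : Subring B) (z : B) (hz : z ^ 2 ∈ R) : Subring B where
  carrier := {b | ∃ r ∈ R, ∃ t ∈ R, b = r + t * z}
  zero_mem' := ⟨0, R.zero_mem, 0, R.zero_mem, by ring⟩
  one_mem' := ⟨1, R.one_mem, 0, R.zero_mem, by ring⟩
  add_mem' := by
    rintro _ _ ⟨r, hr, t, ht, rfl⟩ ⟨r', hr', t', ht', rfl⟩
    exact ⟨r + r', R.add_mem hr hr', t + t', R.add_mem ht ht', by ring⟩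
  neg_mem' := by
    rintro _ ⟨r, hr, t, ht, rfl⟩
    exact ⟨-r, R.neg_mem hr, -t, R.neg_mem ht, by ring⟩
  mul_mem' := by
    rintro _ _ ⟨r, hr, t, ht, rfl⟩ ⟨r', hr', t', ht', rfl⟩
    exact ⟨r * r' + t * t' * z ^ 2,
      R.add_mem (R.mul_mem hr hr') (R.mul_mem (R.mul_mem ht ht') hz),
      r * t' + t * r', R.add_mem (R.mul_mem hr ht') (R.mul_mem ht hr'), by ring⟩

theorem le_adjoinSqrt (R : Subring B) (z : B) (hz : z ^ 2 ∈ R) : R ≤ R.adjoinSqrt z hz :=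
  fun r hr => ⟨r, hr, 0, R.zero_mem, by ring⟩

theorem self_mem_adjoinSqrt (R : Subring B) (z : B) (hz : z ^ 2 ∈ R) : z ∈ R.adjoinSqrt z hz :=
  ⟨0, R.zero_mem, 1, R.one_mem, by ring⟩

end Subring

/-- The subfield of all `a + b * s` with `a, b ∈ F`, where `s ^ 2 ∈ F`. -/
def Subfield.adjoinSqrt {L : Type*} [Field L] (F : Subfield L) (s : L) (hs : s ^ 2 ∈ F) :
    Subfield L where
  __ := F.toSubring.adjoinSqrt s hs
  inv_mem' := by
    rintro _ ⟨a, ha, b, hb, rfl⟩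
    by_cases h : a - b * s = 0
    · have hF : (a + b * s)⁻¹ = a⁻¹ / 2 := by
        rw [← sub_eq_zero.mp h, ← two_mul, mul_inv, div_eq_mul_inv, mul_comm]
      exact ⟨_, F.div_mem (F.inv_mem ha) (ofNat_mem F 2), 0, F.zero_mem, by rw [hF]; ring⟩
    · have hF : a ^ 2 - b ^ 2 * s ^ 2 ∈ F :=
        F.sub_mem (F.pow_mem ha 2) (F.mul_mem (F.pow_mem hb 2) hs)
      refine ⟨a / (a ^ 2 - b ^ 2 * s ^ 2), F.div_mem ha hF, -b / (a ^ 2 - b ^ 2 * s ^ 2),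
        F.div_mem (F.neg_mem hb) hF, ?_⟩
      have : a ^ 2 - b ^ 2 * s ^ 2 = (a + b * s) * (a - b * s) := by ring
      rw [this]
      by_cases h' : a + b * s = 0
      · simp [h']
      · field_simp
        ring

/-- If `t ^ 2` lies in `F` and neither `t` nor `s * t` does, then `t ∉ F(s)`. -/
theorem Subfield.notMem_adjoinSqrt {L : Type*} [Field L] (h2 : (2 : L) ≠ 0) {F : Subfield L}
    {s t : L} (hs : s ^ 2 ∈ F) (hsF : s ∉ F) (ht : t ^ 2 ∈ F) (htF : t ∉ F) (hst : s * t ∉ F) :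
    t ∉ F.adjoinSqrt s hs := by
  rintro ⟨a, ha, b, hb, rfl⟩
  have hab : 2 * a * b = 0 := by
    by_contra hne
    refine hsF ?_
    have : s = ((a + b * s) ^ 2 - (a ^ 2 + b ^ 2 * s ^ 2)) / (2 * a * b) := by
      rw [eq_div_iff hne]
      ring
    rw [this]
    exact F.div_mem (F.sub_mem ht (F.add_mem (F.pow_mem ha 2) (F.mul_mem (F.pow_mem hb 2) hs)))
      (F.mul_mem (F.mul_mem (ofNat_mem F 2) ha) hb)
  rcases mul_eq_zero.mp hab with h | rfl
  · obtain rfl : a = 0 := (mul_eq_zero.mp h).resolve_left h2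
    refine hst ?_
    rw [show s * (0 + b * s) = b * s ^ 2 by ring]
    exact F.mul_mem hb hs
  · exact htF (by simpa using ha)

/-- A ring homomorphism to a field that is injective on `R` is injective on the ring obtained by
adjoining to `R` square roots whose images are multiplicatively independent modulo `F ⊇ f R`. -/
theorem eq_zero_of_mem_closure_sqrt {B L : Type*} [CommRing B] [Field L] (h2 : (2 : L) ≠ 0)
    (f : B →+* L) (zs : List B) (R : Subring B) (F : Subfield L) (hRF : ∀ r ∈ R, f r ∈ F)
    (hR : ∀ r ∈ R, f r = 0 → r = 0) (hz : ∀ z ∈ zs, z ^ 2 ∈ R)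
    (hF : ∀ l : List B, l.Sublist zs → l ≠ [] → f l.prod ∉ F) {b : B}
    (hb : b ∈ Subring.closure (R ∪ {z | z ∈ zs})) (hfb : f b = 0) : b = 0 := by
  induction zs generalizing R F with
  | nil =>
    refine hR b ?_ hfb
    simpa using hb
  | cons z zs ih =>
    have hzR : z ^ 2 ∈ R := hz z (by simp)
    have hzF : f z ^ 2 ∈ F := by
      rw [← map_pow]
      exact hRF _ hzR
    have hfz : f z ∉ F := by simpa using hF [z] (by simp) (by simp)
    refine ih (R.adjoinSqrt z hzR) (F.adjoinSqrt (f z) hzF) ?_ ?_ ?_ ?_ ?_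
    · rintro _ ⟨r, hr, t, ht, rfl⟩
      exact ⟨f r, hRF r hr, f t, hRF t ht, by simp⟩
    · rintro _ ⟨r, hr, t, ht, rfl⟩ h
      rw [map_add, map_mul] at h
      have htz : f t = 0 := by
        by_contra hne
        refine hfz ?_
        rw [show f z = -f r / f t by rw [eq_div_iff hne]; linear_combination h]
        exact F.div_mem (F.neg_mem (hRF r hr)) (hRF t ht)
      obtain rfl := hR t ht htz
      obtain rfl := hR r hr (by simpa using h)
      simp
    · exact fun w hw => R.le_adjoinSqrt z hzR (hz w (by simp [hw]))
    · intro l hl hne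
      refine Subfield.notMem_adjoinSqrt h2 hzF hfz ?_ (hF l (hl.cons z) hne) ?_
      · rw [← map_pow]
        refine hRF _ ?_
        change powMonoidHom 2 l.prod ∈ R
        rw [map_list_prod]
        refine R.list_prod_mem fun x hx => ?_
        obtain ⟨w, hw, rfl⟩ := List.mem_map.mp hx
        exact hz w (by simp [hl.subset hw])
      · simpa using hF (z :: l) (hl.cons_cons z) (by simp)
    · refine Subring.closure_mono ?_ hb
      rintro x (hx | hx)
      · exact Or.inl (R.le_adjoinSqrt z hzR hx)
      · rcases List.mem_cons.mp hx with rfl | hx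
        · exact Or.inl (R.self_mem_adjoinSqrt x hzR)
        · exact Or.inr hx

theorem ringKrullDim_eq_of_isIntegral {R S : Type*} [CommRing R] [CommRing S] (f : R →+* S)
    (hf : f.IsIntegral) (hinj : Function.Injective f) : ringKrullDim S = ringKrullDim R := by
  algebraize [f]
  have : FaithfulSMul R S := (faithfulSMul_iff_algebraMap_injective R S).mpr hinj
  refine le_antisymm (Order.krullDim_le_of_strictMono (PrimeSpectrum.comap f)
    fun I J h => Ideal.IsIntegral.comap_lt_comap (R := R) (A := S) h) (iSup_le fun l => ?_)
  obtain ⟨P, hP, hPl⟩ := Ideal.nonempty_primesOver (S := S) l.head.asIdeal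
  obtain ⟨series, hlen, -⟩ := Ideal.exists_ltSeries_of_hasGoingUp l P
  rw [← hlen]
  exact Order.LTSeries.length_le_krullDim series

/-- The polynomials in the edges `W₁, W₂, W₃`. -/
noncomputable def edgeHom :
    MvPolynomial (Fin 3) ℚ →+* MvPolynomial (Fin 7) ℚ ⧸ boxIdeal :=
  (Ideal.Quotient.mk boxIdeal).comp (rename (Fin.castAdd 4)).toRingHom

/-- The classes of the diagonals `Z₁, Z₂, Z₃, C`. -/
noncomputable def diagonal (i : Fin 4) : MvPolynomial (Fin 7) ℚ ⧸ boxIdeal :=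
  Ideal.Quotient.mk boxIdeal (X (Fin.natAdd 3 i))

/-- The squares of the diagonals, in terms of the edges. -/
noncomputable def diagonalSq : Fin 4 → MvPolynomial (Fin 3) ℚ :=
  ![X 1 ^ 2 + X 2 ^ 2, X 0 ^ 2 + X 2 ^ 2, X 0 ^ 2 + X 1 ^ 2, X 0 ^ 2 + X 1 ^ 2 + X 2 ^ 2]

theorem diagonal_sq (i : Fin 4) : diagonal i ^ 2 = edgeHom (diagonalSq i) := by
  rw [diagonal, edgeHom, RingHom.comp_apply, ← map_pow, eq_comm, Ideal.Quotient.eq]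
  refine Ideal.subset_span ?_
  fin_cases i <;> simp [diagonalSq, Fin.natAdd, Fin.castAdd, Fin.castLE]

theorem closure_edge_diagonal :
    Subring.closure ((edgeHom.range : Set _) ∪ {z | z ∈ List.map diagonal [0, 1, 2, 3]}) = ⊤ := by
  refine eq_top_iff.mpr fun b _ => ?_
  obtain ⟨p, rfl⟩ := Ideal.Quotient.mk_surjective b
  induction p using MvPolynomial.induction_on with
  | C a => exact Subring.subset_closure (Or.inl ⟨C a, by simp [edgeHom]⟩)
  | add p q hp hq =>
    rw [map_add]
    exact add_mem (hp trivial) (hq trivial)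
  | mul_X p i hp =>
    rw [map_mul]
    refine mul_mem (hp trivial) (Subring.subset_closure ?_)
    induction i using Fin.addCases (m := 3) (n := 4) with
    | left i => exact Or.inl ⟨X i, by simp [edgeHom]⟩
    | right i => exact Or.inr (by fin_cases i <;> simp [diagonal])

theorem isIntegral_edgeHom : edgeHom.IsIntegral := by
  intro b
  have hb : b ∈ (⊤ : Subring _) := trivial
  rw [← closure_edge_diagonal] at hb
  induction hb using Subring.closure_induction with
  | mem x hx =>
    rcases hx with ⟨a, rfl⟩ | hx
    · exact edgeHom.isIntegralElem_map
    · obtain ⟨i, -, rfl⟩ := List.mem_map.mp hx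
      refine ⟨Polynomial.X ^ 2 - Polynomial.C (diagonalSq i),
        Polynomial.monic_X_pow_sub_C _ two_ne_zero, ?_⟩
      simp [diagonal_sq]
  | zero => exact edgeHom.isIntegralElem_zero
  | one => exact edgeHom.isIntegralElem_one
  | add x y _ _ hx hy => exact hx.add edgeHom hy
  | neg x _ hx => exact hx.neg edgeHom
  | mul x y _ _ hx hy => exact hx.mul edgeHom hy

/-- At edges `1, 2, 3` the squares of the diagonals are independent modulo rational squares, so
their products are not squares of polynomials. -/
theorem not_isSquare_prod_diagonalSq {l : List (Fin 4)} (hl : l.Sublist [0, 1, 2, 3])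
    (hne : l ≠ []) : ¬ IsSquare (l.map diagonalSq).prod := by
  intro h
  have key := h.map (eval (![1, 2, 3] : Fin 3 → ℚ))
  rw [map_list_prod, List.map_map] at key
  have hval : eval (![1, 2, 3] : Fin 3 → ℚ) ∘ diagonalSq =
      Nat.castRingHom ℚ ∘ ![13, 10, 5, 14] := by
    funext i
    fin_cases i <;> norm_num [diagonalSq, show (![1, 2, 3] : Fin 3 → ℚ) 2 = 3 from rfl]
  rw [hval, ← List.map_map, ← map_list_prod, Nat.coe_castRingHom, Rat.isSquare_natCast_iff] at key
  have hmem : l ∈ [0, 1, 2, 3].sublists := List.mem_sublists.mpr hl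
  simp only [List.sublists, List.foldr, List.flatMap_cons, List.flatMap_nil, List.cons_append,
    List.nil_append, List.mem_cons, List.not_mem_nil, or_false] at hmem
  rcases hmem with rfl | rfl | rfl | rfl | rfl | rfl | rfl | rfl | rfl | rfl | rfl | rfl | rfl |
    rfl | rfl | rfl <;> revert key <;> simp at hne ⊢ <;> norm_num

/-- A choice of square roots of the `diagonalSq i` in an algebraic closure yields a point of the
box variety. -/
theorem exists_boxRing_hom {L : Type*} [Field L] [IsAlgClosed L]
    (g : MvPolynomial (Fin 3) ℚ →+* L) :
    ∃ f : MvPolynomial (Fin 7) ℚ ⧸ boxIdeal →+* L, f.comp edgeHom = g := by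
  choose s hs using fun i => IsAlgClosed.exists_pow_nat_eq (g (diagonalSq i)) two_pos
  let φ : MvPolynomial (Fin 7) ℚ →+* L :=
    eval₂Hom (g.comp C) (Fin.addCases (m := 3) (n := 4) (fun i => g (X i)) s)
  have hφ : ∀ p ∈ boxIdeal, φ p = 0 := by
    change boxIdeal ≤ RingHom.ker φ
    rw [boxIdeal, Ideal.span_le]
    have h (i : Fin 4) : φ (X (Fin.natAdd 3 i)) ^ 2 = g (diagonalSq i) := by
      simp only [φ, coe_eval₂Hom, eval₂_X, Fin.addCases_right, hs]
    have hW (i : Fin 3) : φ (X (Fin.castAdd 4 i)) = g (X i) := by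
      simp only [φ, coe_eval₂Hom, eval₂_X, Fin.addCases_left]
    rintro p (rfl | rfl | rfl | rfl) <;>
      simp only [SetLike.mem_coe, RingHom.mem_ker, map_sub, map_add, map_pow, sub_eq_zero]
    · simpa [diagonalSq, ← hW] using (h 2).symm
    · simpa [diagonalSq, ← hW] using (h 1).symm
    · simpa [diagonalSq, ← hW] using (h 0).symm
    · simpa [diagonalSq, ← hW] using (h 3).symm
  refine ⟨Ideal.Quotient.lift boxIdeal φ hφ, MvPolynomial.ringHom_ext (fun r => ?_) fun i => ?_⟩
  · simp only [edgeHom, φ, RingHom.comp_apply, AlgHom.toRingHom_eq_coe, RingHom.coe_coe, rename_C,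
      Ideal.Quotient.lift_mk, coe_eval₂Hom, eval₂_C]
  · simp [edgeHom, φ]

theorem edgeHom_injective : Function.Injective edgeHom := by
  let A := MvPolynomial (Fin 3) ℚ
  obtain ⟨f, hf⟩ := exists_boxRing_hom (algebraMap A (AlgebraicClosure (FractionRing A)))
  refine Function.Injective.of_comp (f := f) ?_
  rw [← RingHom.coe_comp, hf, IsScalarTower.algebraMap_eq A (FractionRing A), RingHom.coe_comp]
  exact (algebraMap (FractionRing A) (AlgebraicClosure (FractionRing A))).injective.comp
    (IsFractionRing.injective A (FractionRing A))

theorem exists_injective_boxRing_hom : ∃ (L : Type) (_ : Field L)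
    (f : MvPolynomial (Fin 7) ℚ ⧸ boxIdeal →+* L), Function.Injective f := by
  let A := MvPolynomial (Fin 3) ℚ
  let K := FractionRing A
  let L := AlgebraicClosure K
  obtain ⟨f, hf⟩ := exists_boxRing_hom (algebraMap A L)
  have hfA : ∀ a, f (edgeHom a) = algebraMap K L (algebraMap A K a) := fun a =>
    (RingHom.congr_fun hf a).trans (IsScalarTower.algebraMap_apply A K L a)
  have hinj : Function.Injective fun a => algebraMap K L (algebraMap A K a) :=
    (algebraMap K L).injective.comp (IsFractionRing.injective A K)
  refine ⟨L, inferInstance, f, (injective_iff_map_eq_zero f).mpr fun b hb => ?_⟩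
  have : CharZero K := algebraRat.charZero K
  have : CharZero L := algebraRat.charZero L
  refine eq_zero_of_mem_closure_sqrt two_ne_zero f (List.map diagonal [0, 1, 2, 3])
    edgeHom.range (algebraMap K L).fieldRange ?_ ?_ ?_ ?_
    (closure_edge_diagonal ▸ Subring.mem_top b) hb
  · rintro _ ⟨a, rfl⟩
    exact ⟨algebraMap A K a, (hfA a).symm⟩
  · rintro _ ⟨a, rfl⟩ h
    rw [hfA] at h
    rw [show a = 0 from hinj (by simpa using h), map_zero]
  · intro z hz
    obtain ⟨i, -, rfl⟩ := List.mem_map.mp hz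
    exact ⟨_, (diagonal_sq i).symm⟩
  · rintro _ hsub hne ⟨k, hk⟩
    obtain ⟨l, hl, rfl⟩ := List.sublist_map_iff.mp hsub
    refine not_isSquare_prod_diagonalSq hl (by simpa using hne) ?_
    have hprod : (l.map diagonal).prod ^ 2 = edgeHom (l.map diagonalSq).prod := by
      rw [← powMonoidHom_apply, map_list_prod, map_list_prod, List.map_map, List.map_map]
      congr 2
      funext i
      exact diagonal_sq i
    have hk2 : k ^ 2 = algebraMap A K (l.map diagonalSq).prod := by
      apply (algebraMap K L).injective
      rw [map_pow, hk, ← map_pow, hprod, hfA]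
    obtain ⟨a, rfl⟩ := IsIntegrallyClosed.exists_algebraMap_eq_of_isIntegral_pow (R := A)
      two_pos (hk2 ▸ isIntegral_algebraMap)
    refine ⟨a, IsFractionRing.injective A K ?_⟩
    rw [← hk2, map_mul, sq]

theorem box_ring_domain_dim_three :
    IsDomain (MvPolynomial (Fin 7) ℚ ⧸ boxIdeal) ∧
      ringKrullDim (MvPolynomial (Fin 7) ℚ ⧸ boxIdeal) = 3 := by
  obtain ⟨L, _, f, hf⟩ := exists_injective_boxRing_hom
  refine ⟨hf.isDomain f, ?_⟩
  rw [ringKrullDim_eq_of_isIntegral edgeHom isIntegral_edgeHom edgeHom_injective]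
  simp
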